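/- arXiv:2103.04292 — 2 statements merged into one kernel-verified Lean document; each statement's English description precedes it below -/
import Mathlib

section
/- Let (X,μ) be a σ-finite measure space and f : X → ℝ⁺ a measurable function with ‖f‖_{L¹(μ)} < ∞. Then for every t > 0, ∫ₜ^∞ λ_f(s) ds + t·λ_f(t) = ∫₀^{λ_f(t)} f*(s) ds. -/
open MeasureTheory ENNReal

/-- The distribution function `λ_f(s) = μ({x : |f(x)| > s})`. -/
noncomputable def distFn {α : Type*} [MeasurableSpace α] (μ : Measure α) (f : α → ℝ)
    (s : ℝ) : ℝ≥0∞ :=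
  μ {x | s < |f x|}

/-- The nonincreasing rearrangement `f*(t) = inf{s > 0 : λ_f(s) ≤ t}` (with value `∞` if no
such `s` exists). -/
noncomputable def rearr {α : Type*} [MeasurableSpace α] (μ : Measure α) (f : α → ℝ)
    (t : ℝ) : ℝ≥0∞ :=
  sInf (ENNReal.ofReal '' {s : ℝ | 0 < s ∧ distFn μ f s ≤ ENNReal.ofReal t})

lemma distFn_antitone {α : Type*} [MeasurableSpace α] (μ : Measure α) (f : α → ℝ) :
    Antitone (distFn μ f) :=
  fun _ _ hab => measure_mono fun _ hx => lt_of_le_of_lt hab hx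

lemma distFn_lt_top {α : Type*} [MeasurableSpace α] {μ : Measure α} {f : α → ℝ}
    (hf : Measurable f) (hf0 : ∀ x, 0 ≤ f x) (hL1 : ∫⁻ x, ENNReal.ofReal (f x) ∂μ < ⊤)
    {t : ℝ} (ht : 0 < t) : distFn μ f t < ⊤ := by
  refine lt_of_le_of_lt (measure_mono fun x hx => ?_)
    (meas_ge_le_lintegral_div (hf.ennreal_ofReal.aemeasurable (μ := μ))
      (ENNReal.ofReal_pos.2 ht).ne' ENNReal.ofReal_ne_top |>.trans_lt
      (ENNReal.div_lt_top hL1.ne (ENNReal.ofReal_pos.2 ht).ne'))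
  have hx' : t < |f x| := hx
  rw [abs_of_nonneg (hf0 x)] at hx'
  exact ENNReal.ofReal_le_ofReal hx'.le

/-- The rearrangement at `t` is the length of the set of levels `s > 0` with `t < λ_f(s)`. -/
lemma rearr_eq_volume {α : Type*} [MeasurableSpace α] (μ : Measure α) (f : α → ℝ) (t : ℝ) :
    rearr μ f t = volume ({s | ENNReal.ofReal t < distFn μ f s} ∩ Set.Ioi 0) := by
  rcases eq_or_ne (rearr μ f t) ⊤ with h | h
  · rw [h]
    have hset : {s | ENNReal.ofReal t < distFn μ f s} ∩ Set.Ioi 0 = Set.Ioi 0 := by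
      refine Set.inter_eq_right.2 fun s hs => ?_
      by_contra hc
      have hle : rearr μ f t ≤ ENNReal.ofReal s := sInf_le ⟨s, ⟨hs, not_lt.1 hc⟩, rfl⟩
      exact ENNReal.ofReal_ne_top (top_le_iff.1 (h ▸ hle))
    rw [hset, Real.volume_Ioi]
  · apply le_antisymm
    · calc rearr μ f t = volume (Set.Ioo 0 (rearr μ f t).toReal) := by
            rw [Real.volume_Ioo, sub_zero, ENNReal.ofReal_toReal h]
        _ ≤ _ := measure_mono fun s hs => by
            refine ⟨?_, hs.1⟩
            by_contra hc
            have hle : rearr μ f t ≤ ENNReal.ofReal s := sInf_le ⟨s, ⟨hs.1, not_lt.1 hc⟩, rfl⟩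
            exact absurd (ENNReal.toReal_le_of_le_ofReal hs.1.le hle) (not_le.2 hs.2)
    · calc _ ≤ volume (Set.Ioc 0 (rearr μ f t).toReal) := measure_mono fun s hs => by
            refine ⟨hs.2, (ENNReal.ofReal_le_iff_le_toReal h).1 (le_sInf ?_)⟩
            rintro _ ⟨r, ⟨-, hr⟩, rfl⟩
            refine ENNReal.ofReal_le_ofReal (le_of_not_gt fun hrs => ?_)
            exact absurd hs.1 (not_lt.2 ((distFn_antitone μ f hrs.le).trans hr))
        _ = rearr μ f t := by
            rw [Real.volume_Ioc, sub_zero, ENNReal.ofReal_toReal h]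

lemma volume_ofReal_lt_inter_Ioo {a : ℝ≥0∞} (ha : a ≠ ⊤) (c : ℝ≥0∞) :
    volume ({r : ℝ | ENNReal.ofReal r < c} ∩ Set.Ioo 0 a.toReal) = min c a := by
  have hm : min c a ≠ ⊤ := ne_top_of_le_ne_top ha (min_le_right _ _)
  have hset : {r : ℝ | ENNReal.ofReal r < c} ∩ Set.Ioo 0 a.toReal =
      Set.Ioo 0 (min c a).toReal := by
    ext r
    simp only [Set.mem_inter_iff, Set.mem_ofPred_eq, Set.mem_Ioo]
    constructor
    · rintro ⟨h1, h2, h3⟩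
      exact ⟨h2, (ENNReal.ofReal_lt_iff_lt_toReal h2.le hm).1
        (lt_min h1 ((ENNReal.ofReal_lt_iff_lt_toReal h2.le ha).2 h3))⟩
    · rintro ⟨h2, h3⟩
      have h4 := lt_min_iff.1 ((ENNReal.ofReal_lt_iff_lt_toReal h2.le hm).2 h3)
      exact ⟨h4.1, h2, (ENNReal.ofReal_lt_iff_lt_toReal h2.le ha).1 h4.2⟩
  rw [hset, Real.volume_Ioo, sub_zero, ENNReal.ofReal_toReal hm]

/-- Layer-cake formula for the integral of the rearrangement over `(0, a)`. -/
lemma lintegral_rearr_Ioo {α : Type*} [MeasurableSpace α] (μ : Measure α) (f : α → ℝ)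
    {a : ℝ≥0∞} (ha : a ≠ ⊤) :
    ∫⁻ r in Set.Ioo 0 a.toReal, rearr μ f r = ∫⁻ s in Set.Ioi 0, min (distFn μ f s) a := by
  have hmeas : Measurable (distFn μ f) := (distFn_antitone μ f).measurable
  have hE : MeasurableSet {p : ℝ × ℝ | ENNReal.ofReal p.1 < distFn μ f p.2} :=
    measurableSet_lt (by fun_prop) (by fun_prop)
  calc ∫⁻ r in Set.Ioo 0 a.toReal, rearr μ f r
      = ∫⁻ r in Set.Ioo 0 a.toReal, (volume.restrict (Set.Ioi 0))
          (Prod.mk r ⁻¹' {p : ℝ × ℝ | ENNReal.ofReal p.1 < distFn μ f p.2}) := by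
        refine lintegral_congr fun r => ?_
        rw [rearr_eq_volume, Measure.restrict_apply (measurable_prodMk_left hE)]
        rfl
    _ = ∫⁻ s in Set.Ioi 0, (volume.restrict (Set.Ioo 0 a.toReal))
          ((fun r => (r, s)) ⁻¹' {p : ℝ × ℝ | ENNReal.ofReal p.1 < distFn μ f p.2}) := by
        rw [← Measure.prod_apply hE, Measure.prod_apply_symm hE]
    _ = ∫⁻ s in Set.Ioi 0, min (distFn μ f s) a := by
        refine lintegral_congr fun s => ?_
        rw [Measure.restrict_apply (measurable_prodMk_right hE),
          ← volume_ofReal_lt_inter_Ioo ha]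
        rfl

/-- For a nonnegative integrable `f`, for every `t > 0`,
`∫ₜ^∞ λ_f(s) ds + t·λ_f(t) = ∫₀^{λ_f(t)} f*(s) ds`. -/
theorem lambda_rearr_identity {X : Type*} [MeasurableSpace X] (μ : Measure X) [SigmaFinite μ]
    (f : X → ℝ) (hf : Measurable f) (hf0 : ∀ x, 0 ≤ f x)
    (hL1 : ∫⁻ x, ENNReal.ofReal (f x) ∂μ < ⊤) :
    ∀ t : ℝ, 0 < t →
      (∫⁻ s in Set.Ioi t, distFn μ f s) + ENNReal.ofReal t * distFn μ f t =
        ∫⁻ s in Set.Ioo 0 ((distFn μ f t).toReal), rearr μ f s := by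
  intro t ht
  rw [lintegral_rearr_Ioo μ f (distFn_lt_top hf hf0 hL1 ht).ne,
    ← Set.Ioc_union_Ioi_eq_Ioi ht.le,
    lintegral_union measurableSet_Ioi (Set.Ioc_disjoint_Ioi le_rfl), add_comm]
  congr 1
  · rw [setLIntegral_congr_fun (g := fun _ => distFn μ f t) measurableSet_Ioc
      fun s hs => min_eq_right (distFn_antitone μ f hs.2), setLIntegral_const,
      Real.volume_Ioc, sub_zero, mul_comm]
  · exact setLIntegral_congr_fun measurableSet_Ioi
      fun s hs => (min_eq_left (distFn_antitone μ f (Set.mem_Ioi.1 hs).le)).symm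
end

section
/- Let A ⊆ [0,1]² be a measurable set, f : [0,1] → [0,1] a measurable function, n ∈ ℕ, i,j,k ∈ {1,…,2ⁿ} with j ≠ k, and A' = σⁿ_{ijk}(A). Assume v_A ≥ f + 2⁻ⁿ a.e. in Xⁿ_j, v_A ≤ f − 2⁻ⁿ a.e. in Xⁿ_k, and ((Qⁿ_{ik} ∩ A) − (2⁻ⁿ(k−j), 0)) ⊊ Qⁿ_{ij} ∩ A. Then ∫₀¹ |f(x) − v_{A'}(x)| dx = ∫₀¹ |f(x) − v_A(x)| dx − |A Δ A'|, where Δ denotes symmetric difference. -/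
open MeasureTheory

/-- The dyadic interval `Xⁿ_j = [2⁻ⁿ(j−1), 2⁻ⁿj)`. -/
def dyadX (n j : ℕ) : Set ℝ := Set.Ico (((j : ℝ) - 1) / 2 ^ n) ((j : ℝ) / 2 ^ n)

/-- The dyadic square `Qⁿ_{ij} = Xⁿ_j × Yⁿ_i`. -/
def dyadQ (n i j : ℕ) : Set (ℝ × ℝ) := dyadX n j ×ˢ dyadX n i

/-- The shifted set `Q + (x₀, y₀) = {(x,y) : (x−x₀, y−y₀) ∈ Q}`. -/
def shiftSet (Q : Set (ℝ × ℝ)) (v : ℝ × ℝ) : Set (ℝ × ℝ) :=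
  {p | (p.1 - v.1, p.2 - v.2) ∈ Q}

/-- The vertical cross section `v_A(x) = ∫₀¹ χ_A(x,z) dz`. -/
noncomputable def vSec (A : Set (ℝ × ℝ)) (x : ℝ) : ℝ :=
  ∫ z in (0 : ℝ)..1, A.indicator (fun _ => (1 : ℝ)) (x, z)

/-- The horizontal cross section `h_A(y) = ∫₀¹ χ_A(z,y) dz`. -/
noncomputable def hSec (A : Set (ℝ × ℝ)) (y : ℝ) : ℝ :=
  ∫ z in (0 : ℝ)..1, A.indicator (fun _ => (1 : ℝ)) (z, y)

/-- The horizontal swapping `σⁿ_{ijk}(A)`: the contents of `A` inside the squares `Qⁿ_{ij}`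
and `Qⁿ_{ik}` change places. -/
def swapSet (n i j k : ℕ) (A : Set (ℝ × ℝ)) : Set (ℝ × ℝ) :=
  (A \ (dyadQ n i j ∪ dyadQ n i k)) ∪
    shiftSet (dyadQ n i j ∩ A) (((k : ℝ) - (j : ℝ)) / 2 ^ n, 0) ∪
    shiftSet (dyadQ n i k ∩ A) (-(((k : ℝ) - (j : ℝ)) / 2 ^ n), 0)

lemma eq_of_mem_dyadX {n j k : ℕ} {x : ℝ} (hj : x ∈ dyadX n j) (hk : x ∈ dyadX n k) :
    j = k := by
  have hp : (0 : ℝ) < 2 ^ n := by positivity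
  obtain ⟨h1, h2⟩ := hj
  obtain ⟨h3, h4⟩ := hk
  rw [div_le_iff₀ hp] at h1 h3
  rw [lt_div_iff₀ hp] at h2 h4
  have h5 : (j : ℝ) < k + 1 := by linarith
  have h6 : (k : ℝ) < j + 1 := by linarith
  norm_cast at h5 h6
  omega

lemma dyadX_subset_Icc {n j : ℕ} (hj : 1 ≤ j) (hj' : j ≤ 2 ^ n) :
    dyadX n j ⊆ Set.Icc 0 1 := by
  have hp : (0 : ℝ) < 2 ^ n := by positivity
  have h1 : (1 : ℝ) ≤ j := by exact_mod_cast hj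
  have h2 : (j : ℝ) ≤ 2 ^ n := by exact_mod_cast hj'
  rintro x ⟨h3, h4⟩
  rw [div_le_iff₀ hp] at h3
  rw [lt_div_iff₀ hp] at h4
  constructor <;> nlinarith

lemma measurableSet_dyadX (n j : ℕ) : MeasurableSet (dyadX n j) := measurableSet_Ico

lemma measurableSet_dyadQ (n i j : ℕ) : MeasurableSet (dyadQ n i j) :=
  (measurableSet_dyadX n j).prod (measurableSet_dyadX n i)

lemma measureReal_dyadX (n j : ℕ) : volume.real (dyadX n j) = 1 / 2 ^ n := by
  rw [dyadX, Real.volume_real_Ico_of_le (by gcongr; linarith)]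
  ring

lemma sub_mem_dyadX {n j k : ℕ} {x : ℝ} :
    x - ((k : ℝ) - j) / 2 ^ n ∈ dyadX n j ↔ x ∈ dyadX n k := by
  simp only [dyadX, Set.mem_Ico, sub_div]
  constructor <;> rintro ⟨h1, h2⟩ <;> constructor <;> linarith

lemma add_mem_dyadX {n j k : ℕ} {x : ℝ} :
    x + ((k : ℝ) - j) / 2 ^ n ∈ dyadX n k ↔ x ∈ dyadX n j := by
  simp only [dyadX, Set.mem_Ico, sub_div]
  constructor <;> rintro ⟨h1, h2⟩ <;> constructor <;> linarith

lemma MeasurableSet.shiftSet {Q : Set (ℝ × ℝ)} (hQ : MeasurableSet Q) (v : ℝ × ℝ) :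
    MeasurableSet (shiftSet Q v) :=
  (show Measurable fun p : ℝ × ℝ => (p.1 - v.1, p.2 - v.2) by fun_prop) hQ

lemma MeasurableSet.swapSet {A : Set (ℝ × ℝ)} (hA : MeasurableSet A) (n i j k : ℕ) :
    MeasurableSet (swapSet n i j k A) :=
  ((hA.diff ((measurableSet_dyadQ n i j).union (measurableSet_dyadQ n i k))).union
    (((measurableSet_dyadQ n i j).inter hA).shiftSet _)).union
    (((measurableSet_dyadQ n i k).inter hA).shiftSet _)

lemma mem_swapSet {n i j k : ℕ} {A : Set (ℝ × ℝ)} {x z : ℝ} :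
    (x, z) ∈ swapSet n i j k A ↔
      ((x, z) ∈ A ∧ ¬ (x ∈ dyadX n j ∧ z ∈ dyadX n i) ∧ ¬ (x ∈ dyadX n k ∧ z ∈ dyadX n i)) ∨
      (x ∈ dyadX n k ∧ z ∈ dyadX n i ∧ (x - ((k : ℝ) - j) / 2 ^ n, z) ∈ A) ∨
      (x ∈ dyadX n j ∧ z ∈ dyadX n i ∧ (x + ((k : ℝ) - j) / 2 ^ n, z) ∈ A) := by
  simp only [swapSet, shiftSet, dyadQ, Set.mem_union, Set.mem_sdiff, Set.mem_inter_iff,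
    Set.mem_prod, Set.mem_ofPred_eq, sub_zero, sub_neg_eq_add, sub_mem_dyadX, add_mem_dyadX]
  tauto

lemma symmDiff_swapSet_subset (n i j k : ℕ) (A : Set (ℝ × ℝ)) :
    symmDiff A (swapSet n i j k A) ⊆ (dyadX n j ∪ dyadX n k) ×ˢ dyadX n i := by
  rintro ⟨x, z⟩ h
  rw [Set.mem_symmDiff, mem_swapSet] at h
  rw [Set.mem_prod, Set.mem_union]
  tauto

lemma mem_of_mem_swapSet {n i j k : ℕ} {A : Set (ℝ × ℝ)} (hjk : j ≠ k)
    (h : shiftSet (dyadQ n i k ∩ A) (-(((k : ℝ) - (j : ℝ)) / 2 ^ n), 0) ⊆ dyadQ n i j ∩ A)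
    {x z : ℝ} (hx : x ∈ dyadX n j) (hz : (x, z) ∈ swapSet n i j k A) : (x, z) ∈ A := by
  rcases mem_swapSet.1 hz with h' | h' | h'
  · exact h'.1
  · exact absurd (eq_of_mem_dyadX hx h'.1) hjk
  · refine (@h (x, z) ?_).2
    simpa [shiftSet, dyadQ, add_mem_dyadX, and_assoc] using h'

lemma mem_swapSet_of_mem {n i j k : ℕ} {A : Set (ℝ × ℝ)}
    (h : shiftSet (dyadQ n i k ∩ A) (-(((k : ℝ) - (j : ℝ)) / 2 ^ n), 0) ⊆ dyadQ n i j ∩ A)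
    {x z : ℝ} (hx : x ∈ dyadX n k) (hz : (x, z) ∈ A) : (x, z) ∈ swapSet n i j k A := by
  rw [mem_swapSet]
  by_cases hzi : z ∈ dyadX n i
  · refine Or.inr (Or.inl ⟨hx, hzi, (@h (x - ((k : ℝ) - j) / 2 ^ n, z) ?_).2⟩)
    simpa [shiftSet, dyadQ] using ⟨⟨hx, hzi⟩, hz⟩
  · exact Or.inl ⟨hz, fun h' => hzi h'.2, fun h' => hzi h'.2⟩

lemma vSec_eq_measureReal {A : Set (ℝ × ℝ)} (hA : MeasurableSet A) (x : ℝ) :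
    vSec A x = volume.real ({z | (x, z) ∈ A} ∩ Set.Ioc 0 1) := by
  have hm : MeasurableSet {z | (x, z) ∈ A} := measurable_prodMk_left hA
  rw [vSec, intervalIntegral.integral_of_le zero_le_one, ← measureReal_restrict_apply hm,
    ← integral_indicator_one hm]
  rfl

lemma vSec_nonneg {A : Set (ℝ × ℝ)} (hA : MeasurableSet A) (x : ℝ) : 0 ≤ vSec A x := by
  rw [vSec_eq_measureReal hA]
  exact measureReal_nonneg

lemma vSec_le_measureReal {A : Set (ℝ × ℝ)} (hA : MeasurableSet A) {x : ℝ} {Y : Set ℝ}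
    (hY : volume Y ≠ ⊤) (h : ∀ z, (x, z) ∈ A → z ∈ Y) : vSec A x ≤ volume.real Y := by
  rw [vSec_eq_measureReal hA]
  exact measureReal_mono (fun z hz => h z hz.1) hY

lemma vSec_le_one {A : Set (ℝ × ℝ)} (hA : MeasurableSet A) (x : ℝ) : vSec A x ≤ 1 := by
  rw [vSec_eq_measureReal hA]
  calc _ ≤ volume.real (Set.Ioc (0 : ℝ) 1) := measureReal_mono Set.inter_subset_right (by simp)
    _ = 1 := by simp

lemma vSec_symmDiff_of_subset {A B : Set (ℝ × ℝ)} (hA : MeasurableSet A) (hB : MeasurableSet B)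
    {x : ℝ} (h : ∀ z, (x, z) ∈ B → (x, z) ∈ A) :
    vSec (symmDiff A B) x = vSec A x - vSec B x := by
  have hm : MeasurableSet {z | (x, z) ∈ B} := measurable_prodMk_left hB
  have hBA : {z | (x, z) ∈ B} ⊆ {z | (x, z) ∈ A} := h
  rw [vSec_eq_measureReal hA, vSec_eq_measureReal hB, vSec_eq_measureReal (hA.symmDiff hB),
    ← measureReal_sdiff (Set.inter_subset_inter_left _ hBA) (hm.inter measurableSet_Ioc)
      (measure_ne_top_of_subset Set.inter_subset_right (by simp))]
  congr 1
  ext z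
  have := h z
  simp only [Set.mem_inter_iff, Set.mem_sdiff, Set.mem_ofPred_eq, Set.mem_symmDiff]
  tauto

lemma measurable_vSec {A : Set (ℝ × ℝ)} (hA : MeasurableSet A) : Measurable (vSec A) := by
  have h : StronglyMeasurable (A.indicator fun _ => (1 : ℝ)) :=
    stronglyMeasurable_const.indicator hA
  have h' := (h.integral_prod_right' (ν := volume.restrict (Set.Ioc (0 : ℝ) 1))).measurable
  convert h' using 2 with x
  rw [vSec, intervalIntegral.integral_of_le zero_le_one]

lemma integrableOn_vSec {A : Set (ℝ × ℝ)} (hA : MeasurableSet A) :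
    IntegrableOn (vSec A) (Set.Ioc 0 1) := by
  refine Integrable.of_bound (measurable_vSec hA).aestronglyMeasurable 1 (.of_forall fun x => ?_)
  rw [Real.norm_of_nonneg (vSec_nonneg hA x)]
  exact vSec_le_one hA x

lemma integral_vSec {A : Set (ℝ × ℝ)} (hA : MeasurableSet A)
    (hsub : A ⊆ Set.Icc (0 : ℝ) 1 ×ˢ Set.Icc (0 : ℝ) 1) :
    ∫ x in (0 : ℝ)..1, vSec A x = volume.real A := by
  simp only [vSec, intervalIntegral.integral_of_le zero_le_one, ← integral_Icc_eq_integral_Ioc]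
  have hfin : volume (Set.Icc (0 : ℝ) 1 ×ˢ Set.Icc (0 : ℝ) 1) ≠ ⊤ :=
    (isCompact_Icc.prod isCompact_Icc).measure_lt_top.ne
  have hint : IntegrableOn (A.indicator fun _ => (1 : ℝ))
      (Set.Icc (0 : ℝ) 1 ×ˢ Set.Icc (0 : ℝ) 1) (volume.prod volume) :=
    (integrableOn_const hfin).indicator hA
  rw [← setIntegral_prod _ hint, ← Measure.volume_eq_prod, setIntegral_indicator hA,
    Set.inter_eq_self_of_subset_right hsub]
  simp

/-- Swapping decreases the `L¹` distance of the vertical cross section to `f` by exactly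
`|A Δ A'|`. -/
theorem swap_L1_distance (A : Set (ℝ × ℝ)) (hA : MeasurableSet A)
    (hsub : A ⊆ Set.Icc (0 : ℝ) 1 ×ˢ Set.Icc (0 : ℝ) 1)
    (f : ℝ → ℝ) (hf : Measurable f) (hf01 : ∀ x ∈ Set.Icc (0 : ℝ) 1, f x ∈ Set.Icc (0 : ℝ) 1)
    (n i j k : ℕ) (hi : 1 ≤ i) (hi' : i ≤ 2 ^ n) (hj : 1 ≤ j) (hj' : j ≤ 2 ^ n)
    (hk : 1 ≤ k) (hk' : k ≤ 2 ^ n) (hjk : j ≠ k)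
    (h1 : ∀ᵐ x : ℝ, x ∈ dyadX n j → f x + 1 / 2 ^ n ≤ vSec A x)
    (h2 : ∀ᵐ x : ℝ, x ∈ dyadX n k → vSec A x ≤ f x - 1 / 2 ^ n)
    (hstrict : shiftSet (dyadQ n i k ∩ A) (-(((k : ℝ) - (j : ℝ)) / 2 ^ n), 0) ⊂
      dyadQ n i j ∩ A) :
    ∫ x in (0 : ℝ)..1, |f x - vSec (swapSet n i j k A) x| =
      (∫ x in (0 : ℝ)..1, |f x - vSec A x|) -
        (volume (symmDiff A (swapSet n i j k A))).toReal := by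
  have hA' := hA.swapSet n i j k
  have hD := hA.symmDiff hA'
  have hDsub := symmDiff_swapSet_subset n i j k A
  have hDIcc : symmDiff A (swapSet n i j k A) ⊆ Set.Icc (0 : ℝ) 1 ×ˢ Set.Icc (0 : ℝ) 1 :=
    hDsub.trans (Set.prod_mono (Set.union_subset (dyadX_subset_Icc hj hj')
      (dyadX_subset_Icc hk hk')) (dyadX_subset_Icc hi hi'))
  have hDle (x : ℝ) : vSec (symmDiff A (swapSet n i j k A)) x ≤ 1 / 2 ^ n := by
    rw [← measureReal_dyadX n i]
    exact vSec_le_measureReal hD (by simp [dyadX]) fun z hz => (hDsub hz).2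
  have hfint : IntegrableOn f (Set.Ioc 0 1) := by
    refine Integrable.of_bound hf.aestronglyMeasurable 1 ?_
    refine (ae_restrict_iff' measurableSet_Ioc).2 (.of_forall fun x hx => ?_)
    obtain ⟨h3, h4⟩ := hf01 x (Set.Ioc_subset_Icc_self hx)
    rwa [Real.norm_of_nonneg h3]
  rw [← Measure.real, ← integral_vSec hD hDIcc]
  simp only [intervalIntegral.integral_of_le zero_le_one]
  have habs : IntegrableOn (fun x => |f x - vSec A x|) (Set.Ioc 0 1) :=
    (hfint.sub (integrableOn_vSec hA)).abs
  rw [← integral_sub habs (integrableOn_vSec hD)]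
  refine integral_congr_ae (ae_restrict_of_ae ?_)
  filter_upwards [h1, h2] with x h1 h2
  have hle := hDle x
  by_cases hxj : x ∈ dyadX n j
  · have h3 := h1 hxj
    have hv := vSec_symmDiff_of_subset hA hA'
      fun z => mem_of_mem_swapSet hjk hstrict.subset hxj
    have h0 := vSec_nonneg hD x
    rw [abs_of_nonpos (by linarith), abs_of_nonpos (by linarith)]
    linarith
  by_cases hxk : x ∈ dyadX n k
  · have h3 := h2 hxk
    have hv := vSec_symmDiff_of_subset hA' hA
      fun z => mem_swapSet_of_mem hstrict.subset hxk
    rw [symmDiff_comm] at hv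
    have h0 := vSec_nonneg hD x
    rw [abs_of_nonneg (by linarith), abs_of_nonneg (by linarith)]
    linarith
  · have hempty (z : ℝ) : (x, z) ∉ symmDiff A (swapSet n i j k A) := fun hz =>
      (hDsub hz).1.elim hxj hxk
    have hv := vSec_symmDiff_of_subset hA hA' (x := x) fun z hz => by
      by_contra hz'
      exact hempty z (Or.inr ⟨hz, hz'⟩)
    have h0 : vSec (symmDiff A (swapSet n i j k A)) x = 0 := by
      simp [vSec_eq_measureReal hD, hempty]
    rw [h0, show vSec (swapSet n i j k A) x = vSec A x by linarith, sub_zero]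
end
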